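/- Let f : S² → ℂ \ {0} be continuous and suppose there is a constant ε ∈ {1, -1} such that f(-x) · conj(f(x)) = ε for all x ∈ S². Then ε = 1. -/

import Mathlib

open Complex in
/-- Inverse stereographic projection of the complex plane onto the unit sphere. -/
noncomputable def complexToSphere (z : ℂ) : Metric.sphere (0 : EuclideanSpace ℝ (Fin 3)) 1 :=
  ⟨!₂[2 * z.re / (normSq z + 1), 2 * z.im / (normSq z + 1), (normSq z - 1) / (normSq z + 1)], by
    have hpos : normSq z + 1 ≠ 0 := by linarith [normSq_nonneg z]
    rw [EuclideanSpace.sphere_zero_eq 1 zero_le_one]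
    simp only [Set.mem_ofPred_eq, Fin.sum_univ_three, Matrix.cons_val]
    field_simp
    rw [normSq_apply]
    ring⟩

theorem continuous_complexToSphere : Continuous complexToSphere := by
  have hpos (z : ℂ) : Complex.normSq z + 1 ≠ 0 := by linarith [Complex.normSq_nonneg z]
  refine Continuous.subtype_mk ((PiLp.continuous_toLp 2 _).comp (continuous_pi fun i ↦ ?_)) _
  have := Complex.continuous_normSq
  fin_cases i <;> simp <;> fun_prop (disch := exact hpos _)

theorem complexToSphere_neg {z : ℂ} (hz : ‖z‖ = 1) :
    complexToSphere (-z) = -complexToSphere z := by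
  ext i
  fin_cases i <;> simp [complexToSphere, Complex.normSq_eq_norm_sq, hz, neg_div]

/-- A nowhere vanishing continuous function on the plane has a continuous logarithm. -/
theorem exists_continuous_exp_eq {g : ℂ → ℂ} (hg : Continuous g) (hne : ∀ z, g z ≠ 0) :
    ∃ F : ℂ → ℂ, Continuous F ∧ ∀ z, Complex.exp (F z) = g z := by
  obtain ⟨F, ⟨-, hF⟩, -⟩ := Complex.isCoveringMapOn_exp.existsUnique_continuousMap_lifts
    ⟨g, hg⟩ (a₀ := 0) (Complex.exp_log (hne 0)) hne
  exact ⟨F, F.continuous, congrFun hF⟩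

/-- A continuous real function on the plane takes equal values at some pair of antipodal points
of the unit circle. -/
theorem exists_norm_eq_one_apply_neg_eq {θ : ℂ → ℝ} (hθ : Continuous θ) :
    ∃ z : ℂ, ‖z‖ = 1 ∧ θ (-z) = θ z := by
  have hconn : IsPreconnected (Metric.sphere (0 : ℂ) 1) :=
    isPreconnected_sphere (by simp) 0 1
  have hmem : (1 : ℂ) ∈ Metric.sphere (0 : ℂ) 1 := by simp
  have hmem_neg : (-1 : ℂ) ∈ Metric.sphere (0 : ℂ) 1 := by simp
  have hcont : Continuous fun z ↦ θ (-z) := hθ.comp continuous_neg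
  obtain ⟨z, hz, hzero⟩ : ∃ z ∈ Metric.sphere (0 : ℂ) 1, θ (-z) = θ z := by
    rcases le_total (θ (-1)) (θ 1) with hle | hle
    · exact hconn.intermediate_value₂ hmem hmem_neg hcont.continuousOn hθ.continuousOn hle
        (by simpa using hle)
    · exact hconn.intermediate_value₂ hmem_neg hmem hcont.continuousOn hθ.continuousOn
        (by simpa using hle) hle
  exact ⟨z, by simpa using hz, hzero⟩

/-- A nowhere vanishing continuous complex function on the sphere has the same phase at some pair
of antipodal points. -/
theorem exists_apply_neg_mul_conj_eq_pos
    {f : Metric.sphere (0 : EuclideanSpace ℝ (Fin 3)) 1 → ℂ}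
    (hf : Continuous f) (hne : ∀ x, f x ≠ 0) :
    ∃ x, ∃ r : ℝ, 0 < r ∧ f (-x) * (starRingEnd ℂ) (f x) = r := by
  obtain ⟨F, hFcont, hF⟩ := exists_continuous_exp_eq (hf.comp continuous_complexToSphere)
    fun z ↦ hne (complexToSphere z)
  obtain ⟨z, hz, him⟩ := exists_norm_eq_one_apply_neg_eq (Complex.continuous_im.comp hFcont)
  refine ⟨complexToSphere z, Real.exp ((F (-z)).re + (F z).re), Real.exp_pos _, ?_⟩
  have hsum : F (-z) + (starRingEnd ℂ) (F z) = (((F (-z)).re + (F z).re : ℝ) : ℂ) := by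
    apply Complex.ext
    · simp
    · simpa [add_neg_eq_zero] using him
  rw [← complexToSphere_neg hz, ← Function.comp_apply (f := f), ← hF (-z),
    ← Function.comp_apply (f := f), ← hF z, ← Complex.exp_conj, ← Complex.exp_add, hsum,
    Complex.ofReal_exp]

/-- If `f : S² → ℂ \ {0}` is continuous and `f (-x) * conj (f x) = ε` for all `x`,
where `ε ∈ {1, -1}`, then `ε = 1`. -/
theorem antipodal_phase_eps_eq_one
    (f : Metric.sphere (0 : EuclideanSpace ℝ (Fin 3)) 1 → ℂ)
    (hf : Continuous f)
    (hne : ∀ x, f x ≠ 0)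
    (ε : ℂ) (hε : ε = 1 ∨ ε = -1)
    (h : ∀ x, f (-x) * (starRingEnd ℂ) (f x) = ε) : ε = 1 := by
  obtain ⟨x, r, hr, hx⟩ := exists_apply_neg_mul_conj_eq_pos hf hne
  refine hε.resolve_right fun hneg ↦ ?_
  rw [h x, hneg] at hx
  have hre : (-1 : ℝ) = r := by simpa using congrArg Complex.re hx
  linarith
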